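/- Let J be an infinite (possibly uncountable) index set, A a unital C*-algebra, (a_j)_{j∈J} a CAR family over J in A, and (α_g)_{g∈ℙ_J} a family of *-algebra automorphisms of A implementing the finite permutations of J. Then a symmetric state φ on A is an extreme point of the convex set of symmetric states if and only if φ is a product state, i.e. φ(A₁·A₂·⋯·Aₘ) = φ(A₁)·φ(A₂)·⋯·φ(Aₘ) whenever j₁,…,jₘ ∈ J are pairwise distinct and each A_k belongs to the C*-subalgebra of A generated by a_{j_k} (equivalently, φ is the product, over all sites, of a single even state on one site). -/

import Mathlib

open scoped ComplexOrder

/-- A state on a unital C*-algebra: a linear functional with `φ 1 = 1` and `φ(x*x) ≥ 0`. -/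
def IsState {A : Type*} [NormedRing A] [StarRing A] [CStarRing A] [NormedAlgebra ℂ A]
    [StarModule ℂ A] [CompleteSpace A] (φ : A →ₗ[ℂ] ℂ) : Prop :=
  φ 1 = 1 ∧ ∀ x : A, 0 ≤ φ (star x * x)

/-- A CAR family over `J` in `A`: a family satisfying the canonical anticommutation
relations and generating `A` as a closed *-subalgebra. -/
def IsCARFamily {J : Type*} {A : Type*} [NormedRing A] [StarRing A] [CStarRing A]
    [NormedAlgebra ℂ A] [StarModule ℂ A] [CompleteSpace A] (a : J → A) : Prop :=
  (∀ j : J, star (a j) * a j + a j * star (a j) = 1) ∧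
  (∀ j k : J, j ≠ k → star (a j) * a k + a k * star (a j) = 0) ∧
  (∀ j k : J, a j * a k + a k * a j = 0) ∧
  (StarAlgebra.adjoin ℂ (Set.range a)).topologicalClosure = ⊤

/-- A permutation moving only finitely many points. -/
def IsFinitePerm {J : Type*} (g : Equiv.Perm J) : Prop :=
  {j : J | g j ≠ j}.Finite

/-- The convex set of symmetric states: states invariant under all the automorphisms
implementing finite permutations. -/
def SymmetricStates {J : Type*} {A : Type*} [NormedRing A] [StarRing A] [CStarRing A]
    [NormedAlgebra ℂ A] [StarModule ℂ A] [CompleteSpace A]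
    (α : Equiv.Perm J → (A ≃⋆ₐ[ℂ] A)) : Set (A →ₗ[ℂ] ℂ) :=
  {ψ | IsState ψ ∧ ∀ g : Equiv.Perm J, IsFinitePerm g → ∀ x : A, ψ (α g x) = ψ x}

/-- A product state: `φ(A₁⋯Aₘ) = φ(A₁)⋯φ(Aₘ)` whenever the `Aₖ` lie in the
C*-subalgebras generated by `a_{jₖ}` for pairwise distinct sites `jₖ`. -/
def IsProductState {J : Type*} {A : Type*} [NormedRing A] [StarRing A] [CStarRing A]
    [NormedAlgebra ℂ A] [StarModule ℂ A] [CompleteSpace A]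
    (a : J → A) (φ : A →ₗ[ℂ] ℂ) : Prop :=
  ∀ (m : ℕ) (j : Fin m → J), Function.Injective j →
    ∀ x : Fin m → A,
      (∀ k : Fin m, x k ∈ (StarAlgebra.adjoin ℂ ({a (j k)} : Set A)).topologicalClosure) →
      φ (List.ofFn x).prod = ∏ k : Fin m, φ (x k)

section helpers

set_option linter.unusedSectionVars false

open Filter Topology

variable {J : Type*} {A : Type*}
    [NormedRing A] [StarRing A] [CStarRing A] [NormedAlgebra ℂ A] [StarModule ℂ A]
    [CompleteSpace A]

lemma pos_star {φ : A →ₗ[ℂ] ℂ} (h : ∀ x : A, 0 ≤ φ (star x * x)) (x : A) :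
    φ (star x) = star (φ x) := by
  have h0 := (Complex.nonneg_iff.1 (h x)).2
  have h1 := (Complex.nonneg_iff.1 (h 1)).2
  have h2 := (Complex.nonneg_iff.1 (h (x + 1))).2
  have h3 := (Complex.nonneg_iff.1 (h (x + Complex.I • (1 : A)))).2
  simp only [star_add, star_smul, add_mul, mul_add, map_add, star_one, one_mul, mul_one,
    smul_mul_assoc, mul_smul_comm, map_smul, Complex.add_im, smul_eq_mul,
    smul_add] at h0 h1 h2 h3
  simp at h0 h1 h2 h3
  apply Complex.ext
  · simp; linarith
  · simp; linarith

lemma cauchy_schwarz {φ : A →ₗ[ℂ] ℂ} (h : ∀ x : A, 0 ≤ φ (star x * x)) (x y : A) :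
    ‖φ (star x * y)‖ ^ 2 ≤ (φ (star x * x)).re * (φ (star y * y)).re := by
  let c : PreInnerProductSpace.Core ℂ A :=
    { inner := fun x y => φ (star x * y)
      conj_inner_symm := fun x y => by
        have := pos_star h (star y * x)
        simp only [star_mul, star_star] at this
        rw [this]; rfl
      re_inner_nonneg := fun x => (Complex.nonneg_iff.1 (h x)).1
      add_left := fun x y z => by simp [add_mul]
      smul_left := fun x y r => by simp }
  have h1 := @InnerProductSpace.Core.inner_mul_inner_self_le ℂ A _ _ _ c x y
  have h2 : φ (star y * x) = star (φ (star x * y)) := by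
    rw [← pos_star h]; simp
  change ‖φ (star x * y)‖ * ‖φ (star y * x)‖ ≤ (φ (star x * x)).re * (φ (star y * y)).re at h1
  rw [h2, norm_star] at h1
  rwa [sq]

lemma pos_sq_le {φ : A →ₗ[ℂ] ℂ} (h : ∀ x : A, 0 ≤ φ (star x * x)) (x : A) :
    (φ (star x * x)).re ≤ ‖x‖ ^ 2 * (φ 1).re := by
  let : CStarAlgebra A := {}
  let := CStarAlgebra.spectralOrder A
  let := CStarAlgebra.spectralOrderedRing A
  have h1 := CStarAlgebra.star_mul_le_algebraMap_norm_sq (a := x)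
  rw [← sub_nonneg, CStarAlgebra.nonneg_iff_eq_star_mul_self] at h1
  obtain ⟨b, hb⟩ := h1
  have h2 := (Complex.nonneg_iff.1 (h b)).1
  rw [← hb, map_sub, IsScalarTower.algebraMap_apply ℝ ℂ A, Algebra.algebraMap_eq_smul_one,
    map_smul] at h2
  simp only [Complex.sub_re, smul_eq_mul] at h2
  rw [show (algebraMap ℝ ℂ (‖x‖^2)) = ((‖x‖^2 : ℝ) : ℂ) from rfl, Complex.re_ofReal_mul] at h2
  linarith

lemma pos_bound {φ : A →ₗ[ℂ] ℂ} (h : ∀ x : A, 0 ≤ φ (star x * x)) (x : A) :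
    ‖φ x‖ ≤ (φ 1).re * ‖x‖ := by
  have h1 := cauchy_schwarz h 1 x
  have h2 := pos_sq_le h x
  have h3 := (Complex.nonneg_iff.1 (h 1)).1
  simp only [star_one, one_mul] at h1 h3
  refine abs_le_of_sq_le_sq' ?_ (by positivity) |>.2
  nlinarith

lemma pos_continuous {φ : A →ₗ[ℂ] ℂ} (h : ∀ x : A, 0 ≤ φ (star x * x)) : Continuous φ :=
  (φ.mkContinuous _ (pos_bound h)).continuous

/-- Sandwich limits along an ultrafilter. -/
lemma exists_limit {φ : A →ₗ[ℂ] ℂ} (h : ∀ x : A, 0 ≤ φ (star x * x)) (u : Ultrafilter ℕ)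
    (z : ℕ → A) (C : ℝ) (hz : ∀ n, ‖z n‖ ≤ C) :
    ∃ ψ : A →ₗ[ℂ] ℂ, ∀ x, Tendsto (fun n => φ (star (z n) * x * z n)) u (𝓝 (ψ x)) := by
  have key : ∀ x, ∃ l, Tendsto (fun n => φ (star (z n) * x * z n)) u (𝓝 l) := by
    intro x
    have hc : IsCompact (Metric.closedBall (0 : ℂ) ((φ 1).re * (C * ‖x‖ * C))) :=
      isCompact_closedBall _ _
    obtain ⟨l, _, hl⟩ := hc.ultrafilter_le_nhds (u.map (fun n => φ (star (z n) * x * z n))) (by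
      rw [le_principal_iff]
      refine Filter.mem_map.2 (Filter.Eventually.of_forall fun n => ?_)
      refine mem_closedBall_zero_iff.2 ?_
      refine (pos_bound h _).trans ?_
      have h3 := (Complex.nonneg_iff.1 (h 1)).1
      simp only [star_one, one_mul] at h3
      have hC : 0 ≤ C := (norm_nonneg _).trans (hz n)
      refine mul_le_mul_of_nonneg_left ?_ h3
      refine (norm_mul_le _ _).trans ?_
      refine mul_le_mul ?_ (hz n) (norm_nonneg _) (by positivity)
      refine (norm_mul_le _ _).trans ?_
      rw [norm_star]
      exact mul_le_mul_of_nonneg_right (hz n) (norm_nonneg _))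
    exact ⟨l, hl⟩
  choose f hf using key
  refine ⟨{ toFun := f, map_add' := ?_, map_smul' := ?_ }, hf⟩
  · intro x y
    refine tendsto_nhds_unique (hf (x + y)) (((hf x).add (hf y)).congr fun n => ?_)
    rw [← map_add]; congr 1; noncomm_ring
  · intro r x
    refine tendsto_nhds_unique (hf (r • x)) (((hf x).const_smul r).congr fun n => ?_)
    rw [← map_smul]; simp

/-- Local algebra. -/
def Loc (a : J → A) (S : Set J) : StarSubalgebra ℂ A := StarAlgebra.adjoin ℂ (a '' S)

/-- Number operators. -/
def num (a : J → A) (j : J) : A := star (a j) * a j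

lemma mem_Loc (a : J → A) {S : Set J} {j : J} (hj : j ∈ S) : a j ∈ Loc a S :=
  StarAlgebra.subset_adjoin ℂ _ (Set.mem_image_of_mem _ hj)

lemma Loc_mono (a : J → A) {S T : Set J} (h : S ⊆ T) : Loc a S ≤ Loc a T :=
  StarAlgebra.adjoin_mono (Set.image_mono h)

section car
variable {a : J → A} (ha : IsCARFamily a)
include ha

lemma car_sq (j : J) : a j * a j = 0 := by
  have := ha.2.2.1 j j
  rw [← two_smul ℂ] at this
  simpa using this

lemma car_sq_star (j : J) : star (a j) * star (a j) = 0 := by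
  rw [← star_mul, car_sq ha, star_zero]

lemma car_mul_star (j : J) : a j * star (a j) = 1 - star (a j) * a j :=
  eq_sub_of_add_eq' (ha.1 j)

lemma car_aa (j k : J) : a j * a k = - (a k * a j) := eq_neg_of_add_eq_zero_left (ha.2.2.1 j k)

lemma car_sa {j k : J} (h : j ≠ k) : star (a j) * a k = - (a k * star (a j)) :=
  eq_neg_of_add_eq_zero_left (ha.2.1 j k h)

lemma car_ss (j k : J) : star (a j) * star (a k) = - (star (a k) * star (a j)) := by
  rw [← star_mul, car_aa ha, star_neg, star_mul]

lemma car_aas (j : J) : a j * (star (a j) * a j) = a j := by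
  rw [← mul_assoc, car_mul_star ha, sub_mul, mul_assoc, car_sq ha]; simp

lemma parity {S : Set J} {j : J} (hj : j ∉ S) {x : A} (hx : x ∈ Loc a S) :
    ∃ y ∈ Loc a S, a j * x = y * a j ∧ star (a j) * x = y * star (a j) ∧
      x * a j = a j * y ∧ x * star (a j) = star (a j) * y := by
  unfold Loc at hx
  induction hx using StarAlgebra.adjoin_induction with
  | mem x h =>
    obtain ⟨k, hk, rfl⟩ := h
    have hjk : j ≠ k := fun h => hj (h ▸ hk)
    refine ⟨- a k, neg_mem (mem_Loc a hk), ?_, ?_, ?_, ?_⟩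
    · rw [car_aa ha]; simp
    · rw [car_sa ha hjk]; simp
    · rw [car_aa ha]; simp
    · rw [mul_neg, car_sa ha hjk]; simp
  | algebraMap r =>
    exact ⟨algebraMap ℂ A r, algebraMap_mem _ r, (Algebra.commutes _ _).symm,
      (Algebra.commutes _ _).symm, Algebra.commutes _ _, Algebra.commutes _ _⟩
  | add x y _ _ hh1 hh2 =>
    obtain ⟨x', hx, h1, h2, h3, h4⟩ := hh1
    obtain ⟨y', hy, k1, k2, k3, k4⟩ := hh2
    refine ⟨x' + y', add_mem hx hy, ?_, ?_, ?_, ?_⟩ <;> simp [mul_add, add_mul, *]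
  | mul x y _ _ hh1 hh2 =>
    obtain ⟨x', hx, h1, h2, h3, h4⟩ := hh1
    obtain ⟨y', hy, k1, k2, k3, k4⟩ := hh2
    refine ⟨x' * y', mul_mem hx hy, ?_, ?_, ?_, ?_⟩
    · rw [← mul_assoc, h1, mul_assoc, k1, mul_assoc]
    · rw [← mul_assoc, h2, mul_assoc, k2, mul_assoc]
    · rw [mul_assoc, k3, ← mul_assoc, h3, mul_assoc]
    · rw [mul_assoc, k4, ← mul_assoc, h4, mul_assoc]
  | star x _ h =>
    obtain ⟨x', hx, h1, h2, h3, h4⟩ := h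
    refine ⟨star x', star_mem hx, ?_, ?_, ?_, ?_⟩
    · simpa using congrArg star h4
    · simpa using congrArg star h3
    · simpa using congrArg star h2
    · simpa using congrArg star h1

lemma num_comm {S : Set J} {j : J} (hj : j ∉ S) {x : A} (hx : x ∈ Loc a S) :
    num a j * x = x * num a j := by
  obtain ⟨y, -, h1, h2, h3, h4⟩ := parity ha hj hx
  rw [num, mul_assoc, h1, ← mul_assoc, ← h4, mul_assoc]

lemma decomp {S : Set J} {j : J} (hj : j ∉ S) {x : A} (hx : x ∈ Loc a (insert j S)) :
    ∃ x0 ∈ Loc a S, ∃ x1 ∈ Loc a S, ∃ x2 ∈ Loc a S, ∃ x3 ∈ Loc a S,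
      x = x0 + x1 * a j + x2 * star (a j) + x3 * num a j := by
  let M : Set A := {x | ∃ x0 ∈ Loc a S, ∃ x1 ∈ Loc a S, ∃ x2 ∈ Loc a S, ∃ x3 ∈ Loc a S,
      x = x0 + x1 * a j + x2 * star (a j) + x3 * num a j}
  have hadd : ∀ x ∈ M, ∀ y ∈ M, x + y ∈ M := by
    rintro _ ⟨x0, h0, x1, h1, x2, h2, x3, h3, rfl⟩ _ ⟨y0, k0, y1, k1, y2, k2, y3, k3, rfl⟩
    exact ⟨x0 + y0, add_mem h0 k0, x1 + y1, add_mem h1 k1, x2 + y2, add_mem h2 k2,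
      x3 + y3, add_mem h3 k3, by noncomm_ring⟩
  have hL : ∀ y ∈ Loc a S, ∀ x ∈ M, y * x ∈ M := by
    rintro y hy _ ⟨x0, h0, x1, h1, x2, h2, x3, h3, rfl⟩
    exact ⟨y * x0, mul_mem hy h0, y * x1, mul_mem hy h1, y * x2, mul_mem hy h2,
      y * x3, mul_mem hy h3, by noncomm_ring⟩
  have ha1 : ∀ x ∈ M, a j * x ∈ M := by
    rintro _ ⟨x0, h0, x1, h1, x2, h2, x3, h3, rfl⟩
    obtain ⟨y0, k0, e0, -⟩ := parity ha hj h0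
    obtain ⟨y1, k1, e1, -⟩ := parity ha hj h1
    obtain ⟨y2, k2, e2, -⟩ := parity ha hj h2
    obtain ⟨y3, k3, e3, -⟩ := parity ha hj h3
    refine ⟨y2, k2, y0 + y3, add_mem k0 k3, 0, zero_mem _, - y2, neg_mem k2, ?_⟩
    simp only [mul_add, ← mul_assoc, e0, e1, e2, e3]
    rw [mul_assoc y1, car_sq ha, mul_assoc y2, car_mul_star ha, mul_assoc y3, num, car_aas ha]
    noncomm_ring
  have ha2 : ∀ x ∈ M, star (a j) * x ∈ M := by
    rintro _ ⟨x0, h0, x1, h1, x2, h2, x3, h3, rfl⟩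
    obtain ⟨y0, k0, -, e0, -⟩ := parity ha hj h0
    obtain ⟨y1, k1, -, e1, -⟩ := parity ha hj h1
    obtain ⟨y2, k2, -, e2, -⟩ := parity ha hj h2
    obtain ⟨y3, k3, -, e3, -⟩ := parity ha hj h3
    refine ⟨0, zero_mem _, 0, zero_mem _, y0, k0, y1, k1, ?_⟩
    simp only [mul_add, ← mul_assoc, e0, e1, e2, e3, num]
    rw [mul_assoc y2, car_sq_star ha, mul_assoc y3, car_sq_star ha]
    noncomm_ring
  have main : ∀ m ∈ M, x * m ∈ M ∧ star x * m ∈ M := by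
    unfold Loc at hx
    induction hx using StarAlgebra.adjoin_induction with
    | mem x h =>
      obtain ⟨k, hk, rfl⟩ := h
      rcases hk with rfl | hk
      · exact fun m hm => ⟨ha1 m hm, ha2 m hm⟩
      · exact fun m hm => ⟨hL _ (mem_Loc a hk) m hm, hL _ (star_mem (mem_Loc a hk)) m hm⟩
    | algebraMap r =>
      exact fun m hm => ⟨hL _ (algebraMap_mem _ r) m hm, hL _ (star_mem (algebraMap_mem _ r)) m hm⟩
    | add x y _ _ h1 h2 =>
      intro m hm
      rw [star_add, add_mul, add_mul]
      exact ⟨hadd _ (h1 m hm).1 _ (h2 m hm).1, hadd _ (h1 m hm).2 _ (h2 m hm).2⟩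
    | mul x y _ _ h1 h2 =>
      intro m hm
      rw [star_mul, mul_assoc, mul_assoc]
      exact ⟨(h1 _ (h2 m hm).1).1, (h2 _ (h1 m hm).2).2⟩
    | star x _ h =>
      intro m hm
      rw [star_star]
      exact (h m hm).symm
  have h1 : (1 : A) ∈ M := ⟨1, one_mem _, 0, zero_mem _, 0, zero_mem _, 0, zero_mem _, by simp⟩
  have := (main 1 h1).1
  rwa [mul_one] at this

lemma num_star (j : J) : star (num a j) = num a j := by simp [num]

lemma num_mul (j : J) : num a j * num a j = num a j := by
  rw [num, mul_assoc, car_aas ha]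

lemma norm_proj {p : A} (h1 : star p = p) (h2 : p * p = p) : ‖p‖ ≤ 1 := by
  have := CStarRing.norm_star_mul_self (x := p)
  rw [h1, h2] at this
  by_contra h
  push Not at h
  nlinarith

lemma mem_one_site {j : J} {x : A}
    (hx : x ∈ (StarAlgebra.adjoin ℂ ({a j} : Set A)).topologicalClosure) :
    ∃ c0 c1 c2 c3 : ℂ, x = c0 • (1 : A) + c1 • a j + c2 • star (a j) + c3 • num a j := by
  let V : Submodule ℂ A := Submodule.span ℂ {1, a j, star (a j), num a j}
  have hfin : FiniteDimensional ℂ V := FiniteDimensional.span_of_finite ℂ (Set.toFinite _)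
  have hcl : IsClosed (V : Set A) := V.closed_of_finiteDimensional
  have hsub : (StarAlgebra.adjoin ℂ ({a j} : Set A) : Set A) ⊆ V := by
    intro y hy
    have hy' : y ∈ Loc a (insert j ∅) := by simpa [Loc] using hy
    obtain ⟨x0, h0, x1, h1, x2, h2, x3, h3, rfl⟩ := decomp ha (Set.notMem_empty j) hy'
    have hbot : ∀ z ∈ Loc a (∅ : Set J), ∃ c : ℂ, z = c • (1 : A) := by
      intro z hz
      have hz : z ∈ (⊥ : StarSubalgebra ℂ A) := StarAlgebra.adjoin_le (by simp) hz
      obtain ⟨c, rfl⟩ := StarSubalgebra.mem_bot.1 hz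
      exact ⟨c, Algebra.algebraMap_eq_smul_one c⟩
    obtain ⟨c0, rfl⟩ := hbot _ h0
    obtain ⟨c1, rfl⟩ := hbot _ h1
    obtain ⟨c2, rfl⟩ := hbot _ h2
    obtain ⟨c3, rfl⟩ := hbot _ h3
    simp only [smul_mul_assoc, one_mul]
    refine add_mem (add_mem (add_mem ?_ ?_) ?_) ?_ <;>
      exact V.smul_mem _ (Submodule.subset_span (by simp))
  have hxV : x ∈ V := by
    have : x ∈ closure (StarAlgebra.adjoin ℂ ({a j} : Set A) : Set A) := hx
    exact closure_minimal hsub hcl this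
  simp only [V, Submodule.mem_span_insert, Submodule.mem_span_singleton] at hxV
  obtain ⟨c0, _, ⟨c1, _, ⟨c2, _, ⟨c3, rfl⟩, rfl⟩, rfl⟩, rfl⟩ := hxV
  exact ⟨c0, c1, c2, c3, by abel⟩

lemma one_site_le {j : J} {x : A}
    (hx : x ∈ (StarAlgebra.adjoin ℂ ({a j} : Set A)).topologicalClosure) :
    x ∈ Loc a {j} := by
  obtain ⟨c0, c1, c2, c3, rfl⟩ := mem_one_site ha hx
  have h := mem_Loc a (Set.mem_singleton j)
  exact add_mem (add_mem (add_mem (SMulMemClass.smul_mem _ (one_mem _))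
    (SMulMemClass.smul_mem _ h)) (SMulMemClass.smul_mem _ (star_mem h)))
    (SMulMemClass.smul_mem _ (mul_mem (star_mem h) h))

omit ha in
lemma exists_finite {x : A} (hx : x ∈ StarAlgebra.adjoin ℂ (Set.range a)) :
    ∃ S : Finset J, x ∈ Loc a (S : Set J) := by
  classical
  induction hx using StarAlgebra.adjoin_induction with
  | mem x h =>
    obtain ⟨k, rfl⟩ := h
    exact ⟨{k}, mem_Loc a (by simp)⟩
  | algebraMap r => exact ⟨∅, algebraMap_mem _ r⟩
  | add x y _ _ h1 h2 =>
    obtain ⟨S, hS⟩ := h1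
    obtain ⟨T, hT⟩ := h2
    exact ⟨S ∪ T, add_mem (Loc_mono a (by simp) hS) (Loc_mono a (by simp) hT)⟩
  | mul x y _ _ h1 h2 =>
    obtain ⟨S, hS⟩ := h1
    obtain ⟨T, hT⟩ := h2
    exact ⟨S ∪ T, mul_mem (Loc_mono a (by simp) hS) (Loc_mono a (by simp) hT)⟩
  | star x _ h =>
    obtain ⟨S, hS⟩ := h
    exact ⟨S, star_mem hS⟩

lemma ext_local {φ ψ : A →ₗ[ℂ] ℂ} (h1 : Continuous φ) (h2 : Continuous ψ)
    (h : ∀ (S : Finset J), ∀ x ∈ Loc a (S : Set J), φ x = ψ x) : φ = ψ := by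
  have hd : Dense (StarAlgebra.adjoin ℂ (Set.range a) : Set A) := by
    rw [dense_iff_closure_eq, ← StarSubalgebra.topologicalClosure_coe, ha.2.2.2]
    rfl
  have := h1.ext_on hd h2 (fun x hx => by
    obtain ⟨S, hS⟩ := exists_finite hx
    exact h S x hS)
  exact DFunLike.coe_injective this

end car
lemma avg_zero [Infinite J] {ψ : A →ₗ[ℂ] ℂ} (h : ∀ x : A, 0 ≤ ψ (star x * x)) (S : Finset J)
    (x : A) (f : J → A) (c : ℂ) (hc : ∀ k ∉ S, ψ (x * f k) = c) (K : ℝ)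
    (hK : ∀ T : Finset J, (ψ (star (∑ i ∈ T, f i) * ∑ i ∈ T, f i)).re ≤ K * T.card) : c = 0 := by
  by_contra hne
  have hcpos : 0 < ‖c‖ ^ 2 := by positivity
  set D := (ψ (star (star x) * star x)).re with hD
  have hD0 : 0 ≤ D := (Complex.nonneg_iff.1 (h _)).1
  obtain ⟨N, hN⟩ := exists_nat_gt (D * K / ‖c‖ ^ 2)
  obtain ⟨T, hT, hTc⟩ := (S.finite_toSet.infinite_compl).exists_subset_card_eq (N + 1)
  have h1 := cauchy_schwarz h (star x) (∑ i ∈ T, f i)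
  have h2 : ψ (star (star x) * ∑ i ∈ T, f i) = (N + 1 : ℕ) * c := by
    rw [star_star, Finset.mul_sum, map_sum, Finset.sum_congr rfl (fun i hi => hc i (hT hi)),
      Finset.sum_const, hTc, nsmul_eq_mul]
  rw [h2, norm_mul, Complex.norm_natCast] at h1
  have h3 := hK T
  rw [hTc] at h3
  have h4 := mul_le_mul_of_nonneg_left h3 hD0
  have h5 : ((N + 1 : ℕ) : ℝ) * (((N + 1 : ℕ) : ℝ) * ‖c‖ ^ 2) ≤ ((N + 1 : ℕ) : ℝ) * (D * K) := by
    nlinarith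
  have h6 := le_of_mul_le_mul_left h5 (by positivity)
  rw [div_lt_iff₀ hcpos] at hN
  push_cast at h6
  nlinarith

section sym
variable {a : J → A} (ha : IsCARFamily a) {α : Equiv.Perm J → (A ≃⋆ₐ[ℂ] A)}
    (hα : ∀ g : Equiv.Perm J, IsFinitePerm g → ∀ j : J, α g (a j) = a (g j))

lemma swap_finite [DecidableEq J] (i k : J) : IsFinitePerm (Equiv.swap i k) := by
  refine Set.Finite.subset (Set.toFinite {i, k}) fun j hj => ?_
  by_contra h
  simp only [Set.mem_insert_iff, Set.mem_singleton_iff, not_or] at h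
  exact hj (Equiv.swap_apply_of_ne_of_ne h.1 h.2)

include hα

lemma alpha_fix {g : Equiv.Perm J} (hg : IsFinitePerm g) {S : Set J} (hS : ∀ j ∈ S, g j = j)
    {x : A} (hx : x ∈ Loc a S) : α g x = x := by
  unfold Loc at hx
  induction hx using StarAlgebra.adjoin_induction with
  | mem x h =>
    obtain ⟨k, hk, rfl⟩ := h
    rw [hα g hg, hS k hk]
  | algebraMap r => exact AlgHomClass.commutes _ r
  | add x y _ _ h1 h2 => rw [map_add, h1, h2]
  | mul x y _ _ h1 h2 => rw [map_mul, h1, h2]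
  | star x _ h => rw [map_star, h]

lemma alpha_num {g : Equiv.Perm J} (hg : IsFinitePerm g) (j : J) :
    α g (num a j) = num a (g j) := by
  simp [num, map_mul, map_star, hα g hg]

lemma sym_move {ψ : A →ₗ[ℂ] ℂ}
    (hs : ∀ g : Equiv.Perm J, IsFinitePerm g → ∀ x : A, ψ (α g x) = ψ x)
    {f : J → A} (hf : ∀ g : Equiv.Perm J, IsFinitePerm g → ∀ j, α g (f j) = f (g j))
    {S : Set J} {x : A} (hx : x ∈ Loc a S) {i k : J} (hi : i ∉ S) (hk : k ∉ S) :
    ψ (x * f i) = ψ (x * f k) := by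
  classical
  rw [← hs (Equiv.swap i k) (swap_finite i k), map_mul, hf _ (swap_finite i k),
    Equiv.swap_apply_left, alpha_fix hα (swap_finite i k) ?_ hx]
  intro j hj
  exact Equiv.swap_apply_of_ne_of_ne (fun h => hi (h ▸ hj)) (fun h => hk (h ▸ hj))

include ha

omit hα in
lemma sum_car (T : Finset J) : star (∑ i ∈ T, a i) * (∑ i ∈ T, a i) +
    (∑ i ∈ T, a i) * star (∑ i ∈ T, a i) = (T.card : ℂ) • (1 : A) := by
  classical
  have h : ∀ i ∈ T, ∑ k ∈ T, (star (a i) * a k + a k * star (a i)) = 1 := by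
    intro i hi
    rw [Finset.sum_eq_single i, ha.1 i]
    · intro k _ hk
      exact ha.2.1 i k hk.symm
    · exact fun h => absurd hi h
  have h2 := Finset.sum_congr rfl h
  simp only [Finset.sum_add_distrib] at h2
  rw [star_sum, Finset.sum_mul_sum, Finset.sum_mul_sum, Finset.sum_comm (s := T) (t := T)
    (f := fun i j => a i * star (a j)), h2]
  simp [Nat.cast_smul_eq_nsmul]

lemma anni [Infinite J] {ψ : A →ₗ[ℂ] ℂ} (h : ψ ∈ SymmetricStates α) {S : Finset J} {x : A}
    (hx : x ∈ Loc a (S : Set J)) {k : J} (hk : k ∉ S) :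
    ψ (x * a k) = 0 ∧ ψ (x * star (a k)) = 0 := by
  obtain ⟨⟨h1, hpos⟩, hs⟩ := h
  have hsum : ∀ T : Finset J, (ψ (star (∑ i ∈ T, a i) * (∑ i ∈ T, a i))).re +
    (ψ ((∑ i ∈ T, a i) * star (∑ i ∈ T, a i))).re = T.card := by
    intro T
    have := congrArg (fun y => (ψ y).re) (sum_car ha T)
    simpa [h1] using this
  constructor
  · refine avg_zero hpos S x a _ (fun i hi => ?_) 1 fun T => ?_
    · exact sym_move hα hs hα hx (by simpa using hi) (by simpa using hk)
    · have h2 := hsum T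
      have h3 := (Complex.nonneg_iff.1 (hpos (star (∑ i ∈ T, a i)))).1
      rw [star_star] at h3
      linarith
  · refine avg_zero hpos S x (fun i => star (a i)) _ (fun i hi => ?_) 1 fun T => ?_
    · exact sym_move (f := fun i => star (a i)) hα hs (fun g hg j => by rw [map_star, hα g hg]) hx (by simpa using hi)
        (by simpa using hk)
    · have h2 := hsum T
      have h3 := (Complex.nonneg_iff.1 (hpos (∑ i ∈ T, a i))).1
      rw [← star_sum, star_star]
      linarith

omit ha in
lemma num_const {ψ : A →ₗ[ℂ] ℂ} (h : ψ ∈ SymmetricStates α) (i k : J) :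
    ψ (num a i) = ψ (num a k) := by
  have := sym_move (S := ∅) hα h.2 (fun g hg j => alpha_num hα hg j) (one_mem _) (i := i) (k := k)
    (by simp) (by simp)
  simpa using this

/-- A symmetric state dominated by a state with uncorrelated number operators factorizes. -/
lemma factor [Infinite J] {φ ψ : A →ₗ[ℂ] ℂ} (hφ : φ ∈ SymmetricStates α)
    (hψ : ψ ∈ SymmetricStates α)
    (hpr : ∀ i k, i ≠ k → φ (num a i * num a k) = φ (num a i) * φ (num a k))
    (t : ℝ) (ht : 0 < t) (hdom : ∀ x, t * (ψ (star x * x)).re ≤ (φ (star x * x)).re)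
    {S : Finset J} {x : A} (hx : x ∈ Loc a (S : Set J)) {k : J} (hk : k ∉ S) :
    ψ (x * num a k) = φ (num a k) * ψ x := by
  classical
  set p := φ (num a k) with hp
  have hpstar : star p = p := by rw [hp, ← pos_star hφ.1.2, num_star ha]
  have hpi : ∀ i, φ (num a i) = p := fun i => num_const hα hφ i k
  let f : J → A := fun i => num a i - p • (1 : A)
  have hf1 : ∀ i j, φ (star (f i) * f j) = φ (num a i * num a j) - p * p := by
    intro i j
    have : star (f i) * f j = num a i * num a j - p • num a i - p • num a j + (p * p) • 1 := by
      simp only [f, star_sub, star_smul, num_star ha, star_one, hpstar, sub_mul, mul_sub,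
        smul_mul_assoc, mul_smul_comm, one_mul, mul_one, smul_smul, smul_sub]
      abel
    rw [this]
    simp [hpi, hφ.1.1]
  have hf2 : ∀ i j, i ≠ j → φ (star (f i) * f j) = 0 := by
    intro i j hij
    rw [hf1, hpr i j hij, hpi, hpi, sub_self]
  have hsum : ∀ T : Finset J, φ (star (∑ i ∈ T, f i) * ∑ i ∈ T, f i) = T.card * (p - p * p) := by
    intro T
    rw [star_sum, Finset.sum_mul_sum, map_sum]
    have : ∀ i ∈ T, φ (∑ j ∈ T, star (f i) * f j) = p - p * p := by
      intro i hi
      rw [map_sum, Finset.sum_eq_single i, hf1, num_mul ha, hpi]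
      · intro j _ hj
        exact hf2 i j hj.symm
      · exact fun h => absurd hi h
    rw [Finset.sum_congr rfl this, Finset.sum_const, nsmul_eq_mul]
  have key : ψ (x * f k) = 0 := by
    refine avg_zero hψ.1.2 S x f _ (fun i hi => ?_) ((p - p * p).re / t) fun T => ?_
    · refine sym_move hα hψ.2 (fun g hg j => ?_) hx (by simpa using hi) (by simpa using hk)
      simp [f, alpha_num hα hg]
    · have h1 := hdom (∑ i ∈ T, f i)
      rw [hsum, ← Complex.ofReal_natCast, Complex.re_ofReal_mul] at h1
      rw [div_mul_eq_mul_div, le_div_iff₀ ht]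
      linarith
  simp only [f, mul_sub, mul_smul_comm, mul_one, map_sub, map_smul, smul_eq_mul] at key
  exact sub_eq_zero.1 key

lemma eq_of_factor [Infinite J] {φ ψ : A →ₗ[ℂ] ℂ} (hφ : φ ∈ SymmetricStates α)
    (hψ : ψ ∈ SymmetricStates α)
    (h1 : ∀ (S : Finset J), ∀ x ∈ Loc a (S : Set J), ∀ k ∉ S,
      ψ (x * num a k) = φ (num a k) * ψ x)
    (h2 : ∀ (S : Finset J), ∀ x ∈ Loc a (S : Set J), ∀ k ∉ S,
      φ (x * num a k) = φ (num a k) * φ x) : ψ = φ := by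
  classical
  refine ext_local ha (pos_continuous hψ.1.2) (pos_continuous hφ.1.2) fun S => ?_
  induction S using Finset.induction_on with
  | empty =>
    intro x hx
    have hz : x ∈ (⊥ : StarSubalgebra ℂ A) := StarAlgebra.adjoin_le (by simp) hx
    obtain ⟨c, rfl⟩ := StarSubalgebra.mem_bot.1 hz
    rw [Algebra.algebraMap_eq_smul_one, map_smul, map_smul, hψ.1.1, hφ.1.1]
  | insert j S hj ih =>
    intro x hx
    rw [Finset.coe_insert] at hx
    obtain ⟨x0, k0, x1, k1, x2, k2, x3, k3, rfl⟩ := decomp ha (by simpa using hj) hx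
    simp only [map_add, (anni ha hα hψ k1 hj).1, (anni ha hα hφ k1 hj).1,
      (anni ha hα hψ k2 hj).2, (anni ha hα hφ k2 hj).2, h1 S x3 k3 j hj, h2 S x3 k3 j hj,
      ih x0 k0, ih x3 k3]

lemma product_extreme [Infinite J] {φ : A →ₗ[ℂ] ℂ} (hφ : φ ∈ SymmetricStates α)
    (hpr : IsProductState a φ) : φ ∈ Set.extremePoints ℝ (SymmetricStates α) := by
  have hn : ∀ i k, i ≠ k → φ (num a i * num a k) = φ (num a i) * φ (num a k) := by
    intro i k hik
    have := hpr 2 ![i, k] (by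
      intro u v huv
      fin_cases u <;> fin_cases v <;> simp_all) ![num a i, num a k] (by
      intro u
      apply StarSubalgebra.le_topologicalClosure
      fin_cases u
      · have := StarAlgebra.self_mem_adjoin_singleton ℂ (a i)
        exact mul_mem (star_mem this) this
      · have := StarAlgebra.self_mem_adjoin_singleton ℂ (a k)
        exact mul_mem (star_mem this) this)
    simpa [Fin.prod_univ_two, List.ofFn_succ] using this
  refine mem_extremePoints_iff_left.2 ⟨hφ, fun ψ hψ χ hχ hseg => ?_⟩
  obtain ⟨t, s, ht, hs, _, rfl⟩ := hseg
  refine eq_of_factor ha hα hφ hψ ?_ ?_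
  · intro S x hx k hk
    refine factor ha hα hφ hψ hn t ht (fun y => ?_) hx hk
    have := (Complex.nonneg_iff.1 (hχ.1.2 y)).1
    simp
    positivity
  · intro S x hx k hk
    exact factor ha hα hφ hφ hn 1 one_pos (fun y => by rw [one_mul]) hx hk

omit ha hα in
lemma extreme_split {φ ψ χ : A →ₗ[ℂ] ℂ} (hφ : φ ∈ Set.extremePoints ℝ (SymmetricStates α))
    (hψ : ∀ x, 0 ≤ ψ (star x * x)) (hχ : ∀ x, 0 ≤ χ (star x * x))
    (hψs : ∀ g : Equiv.Perm J, IsFinitePerm g → ∀ x : A, ψ (α g x) = ψ x)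
    (hχs : ∀ g : Equiv.Perm J, IsFinitePerm g → ∀ x : A, χ (α g x) = χ x)
    (hsum : ψ + χ = φ) : ∀ x, ψ x = ψ 1 * φ x := by
  have zero : ∀ θ : A →ₗ[ℂ] ℂ, (∀ x, 0 ≤ θ (star x * x)) → (θ 1).re = 0 → ∀ x, θ x = 0 := by
    intro θ hθ h0 x
    have := pos_bound hθ x
    rw [h0, zero_mul] at this
    exact norm_le_zero_iff.1 this
  have real : ∀ θ : A →ₗ[ℂ] ℂ, (∀ x, 0 ≤ θ (star x * x)) → 0 ≤ (θ 1).re ∧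
      θ 1 = ((θ 1).re : ℂ) := by
    intro θ hθ
    have := hθ 1
    rw [star_one, one_mul, Complex.nonneg_iff] at this
    exact ⟨this.1, Complex.ext (by simp) (by simp [← this.2])⟩
  have h1 : ψ 1 + χ 1 = 1 := by
    rw [← LinearMap.add_apply, hsum]; exact hφ.1.1.1
  obtain ⟨a1, a2⟩ := real ψ hψ
  obtain ⟨b1, b2⟩ := real χ hχ
  intro x
  rcases a1.eq_or_lt with a0 | a0
  · rw [a2, zero ψ hψ a0.symm x, ← a0]; simp
  rcases b1.eq_or_lt with b0 | b0
  · have hx : ψ x = φ x := by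
      rw [← hsum, LinearMap.add_apply, zero χ hχ b0.symm x, add_zero]
    rw [b2, ← b0, Complex.ofReal_zero, add_zero] at h1
    rw [h1, one_mul, hx]
  have norm : ∀ θ : A →ₗ[ℂ] ℂ, (∀ x, 0 ≤ θ (star x * x)) →
      (∀ g : Equiv.Perm J, IsFinitePerm g → ∀ x : A, θ (α g x) = θ x) → 0 < (θ 1).re →
      (θ 1).re⁻¹ • θ ∈ SymmetricStates α := by
    intro θ hθ hs hpos
    refine ⟨⟨?_, fun x => ?_⟩, fun g hg x => ?_⟩
    · rw [LinearMap.smul_apply, (real θ hθ).2, Complex.ofReal_re, Complex.real_smul,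
        ← Complex.ofReal_mul, inv_mul_cancel₀ hpos.ne', Complex.ofReal_one]
    · rw [LinearMap.smul_apply, Complex.real_smul]
      exact mul_nonneg (by exact_mod_cast (inv_pos.2 hpos).le) (hθ x)
    · rw [LinearMap.smul_apply, LinearMap.smul_apply, hs g hg]
  have h2 := (mem_extremePoints_iff_left.1 hφ).2 _ (norm ψ hψ hψs a0) _ (norm χ hχ hχs b0)
    ⟨(ψ 1).re, (χ 1).re, a0, b0, by simpa using congrArg Complex.re h1, by
      rw [smul_inv_smul₀ a0.ne', smul_inv_smul₀ b0.ne', hsum]⟩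
  rw [← h2, LinearMap.smul_apply, Complex.real_smul, ← mul_assoc, a2, Complex.ofReal_re,
    ← Complex.ofReal_mul, mul_inv_cancel₀ a0.ne', Complex.ofReal_one, one_mul]

lemma extreme_factor [Infinite J] {φ : A →ₗ[ℂ] ℂ}
    (hφ : φ ∈ Set.extremePoints ℝ (SymmetricStates α)) {S : Finset J} {x : A}
    (hx : x ∈ Loc a (S : Set J)) {k : J} (hk : k ∉ S) :
    φ (x * num a k) = φ (num a k) * φ x := by
  have hpos := hφ.1.1.2
  have hsym := hφ.1.2
  let j : ℕ → J := Infinite.natEmbedding J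
  have hj : Function.Injective j := (Infinite.natEmbedding J).injective
  let u : Ultrafilter ℕ := hyperfilter ℕ
  have hev : ∀ T : Set J, T.Finite → ∀ᶠ n in (u : Filter ℕ), j n ∉ T := by
    intro T hT
    refine Filter.Eventually.filter_mono hyperfilter_le_cofinite ?_
    exact hj.tendsto_cofinite.eventually hT.eventually_cofinite_notMem
  let mu : J → A := fun i => 1 - num a i
  have mu_star : ∀ i, star (mu i) = mu i := fun i => by simp [mu, num_star ha]
  have mu_mul : ∀ i, mu i * mu i = mu i := fun i => by simp [mu, sub_mul, mul_sub, num_mul ha]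
  obtain ⟨ψ, hψ⟩ := exists_limit hpos u (fun n => num a (j n)) 1
    (fun n => norm_proj ha (num_star ha _) (num_mul ha _))
  obtain ⟨χ, hχ⟩ := exists_limit hpos u (fun n => mu (j n)) 1
    (fun n => norm_proj ha (mu_star _) (mu_mul _))
  have limpos : ∀ (z : ℕ → A) (θ : A →ₗ[ℂ] ℂ),
      (∀ x, Tendsto (fun n => φ (star (z n) * x * z n)) u (𝓝 (θ x))) →
      ∀ x, 0 ≤ θ (star x * x) := by
    intro z θ hθ x
    refine ge_of_tendsto (hθ _) (Filter.Eventually.of_forall fun n => ?_)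
    have := hpos (x * z n)
    simpa [mul_assoc] using this
  have limsym : ∀ (z : J → A) (θ : A →ₗ[ℂ] ℂ),
      (∀ g : Equiv.Perm J, IsFinitePerm g → ∀ j, α g (z j) = z (g j)) →
      (∀ x, Tendsto (fun n => φ (star (z (j n)) * x * z (j n))) u (𝓝 (θ x))) →
      ∀ g : Equiv.Perm J, IsFinitePerm g → ∀ x, θ (α g x) = θ x := by
    intro z θ hz hθ g hg x
    refine tendsto_nhds_unique (hθ (α g x)) ((hθ x).congr' ?_)
    filter_upwards [hev _ hg] with n hn
    have hn' : g (j n) = j n := by simpa using hn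
    rw [← hsym g hg]
    simp only [map_mul, map_star, hz g hg, hn']
  have hψp := limpos _ ψ hψ
  have hχp := limpos _ χ hχ
  have hsum : ψ + χ = φ := by
    refine ext_local ha ((pos_continuous hψp).add (pos_continuous hχp)) (pos_continuous hpos) ?_
    intro T y hy
    refine tendsto_nhds_unique ((hψ y).add (hχ y)) (tendsto_const_nhds.congr' ?_)
    filter_upwards [hev _ T.finite_toSet] with n hn
    have hc := num_comm ha hn hy
    have hc' : mu (j n) * y = y * mu (j n) := by simp [mu, sub_mul, mul_sub, hc]
    rw [num_star ha, mu_star, hc, hc', mul_assoc, mul_assoc, num_mul ha, mu_mul, ← map_add]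
    simp [mu, mul_sub]
  have main := extreme_split hφ hψp hχp
    (limsym _ ψ (fun g hg i => alpha_num hα hg i) hψ)
    (limsym _ χ (fun g hg i => by simp [mu, alpha_num hα hg]) hχ) hsum
  have val : ∀ (T : Finset J) (y : A), y ∈ Loc a (T : Set J) → ∀ i ∉ T,
      ψ y = φ (y * num a i) := by
    intro T y hy i hi
    refine tendsto_nhds_unique (hψ y) (tendsto_const_nhds.congr' ?_)
    filter_upwards [hev _ T.finite_toSet] with n hn
    rw [num_star ha, num_comm ha hn hy, mul_assoc, num_mul ha]
    exact sym_move hα hsym (fun g hg i => alpha_num hα hg i) hy (by simpa using hi) hn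
  rw [← val S x hx k hk, main x, val ∅ 1 (one_mem _) k (by simp), one_mul]

lemma extreme_product [Infinite J] {φ : A →ₗ[ℂ] ℂ}
    (hφ : φ ∈ Set.extremePoints ℝ (SymmetricStates α)) : IsProductState a φ := by
  classical
  have step : ∀ (S : Finset J) (x : A), x ∈ Loc a (S : Set J) → ∀ k ∉ S, ∀ y ∈
      (StarAlgebra.adjoin ℂ ({a k} : Set A)).topologicalClosure, φ (x * y) = φ x * φ y := by
    intro S x hx k hk y hy
    obtain ⟨c0, c1, c2, c3, rfl⟩ := mem_one_site ha hy
    have h1 := anni ha hα hφ.1 hx hk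
    have h2 := anni ha hα hφ.1 (S := ∅) (x := 1) (one_mem _) (k := k) (by simp)
    rw [one_mul, one_mul] at h2
    simp only [mul_add, mul_smul_comm, map_add, map_smul, h1, h2, mul_one,
      extreme_factor ha hα hφ hx hk, hφ.1.1.1, smul_eq_mul]
    ring
  intro m
  induction m with
  | zero => intro j _ x _; simpa using hφ.1.1.1
  | succ m ih =>
    intro j hj x hx
    rw [List.ofFn_succ', List.concat_eq_append, List.prod_append, List.prod_singleton,
      Fin.prod_univ_castSucc]
    rw [← ih (fun i => j i.castSucc) (hj.comp (Fin.castSucc_injective m)) (fun i => x i.castSucc)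
      (fun i => hx i.castSucc)]
    refine step (Finset.univ.image fun i : Fin m => j i.castSucc) _ ?_ (j (Fin.last m)) ?_ _
      (hx _)
    · refine list_prod_mem fun y hy => ?_
      obtain ⟨i, rfl⟩ := (List.mem_ofFn' _ _).1 hy
      refine Loc_mono a ?_ (one_site_le ha (hx i.castSucc))
      simp
    · simp only [Finset.mem_image, Finset.mem_univ, true_and, not_exists]
      intro i hi
      exact (Fin.castSucc_lt_last i).ne (hj hi)

end sym

end helpers

/-- **De Finetti theorem for the CAR algebra, general (possibly uncountable) case.**
A symmetric state on the CAR algebra over an infinite index set `J` is an extreme point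
of the convex set of symmetric states if and only if it is a product state. -/
theorem symmetric_state_extreme_iff_product {J : Type*} [Infinite J] {A : Type*}
    [NormedRing A] [StarRing A] [CStarRing A] [NormedAlgebra ℂ A] [StarModule ℂ A]
    [CompleteSpace A]
    (a : J → A) (ha : IsCARFamily a)
    (α : Equiv.Perm J → (A ≃⋆ₐ[ℂ] A))
    (hα : ∀ g : Equiv.Perm J, IsFinitePerm g → ∀ j : J, α g (a j) = a (g j))
    (φ : A →ₗ[ℂ] ℂ) (hφ : φ ∈ SymmetricStates α) :
    φ ∈ Set.extremePoints ℝ (SymmetricStates α) ↔ IsProductState a φ := by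
  exact ⟨fun h => extreme_product ha hα h, fun h => product_extreme ha hα hφ h⟩
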